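/- (Representation lemma) Let r ≥ 1 be a real number and let g be analytic on the closed disk D(0,r). Then there exist unique constants β, γ ∈ ℂ and a function h analytic on the closed disk D(0,r), unique on {|z| ≤ r}, such that for all z with |z| ≤ r: g(z) = β + γ·(z−1) + z·(z−1)²·(deriv h z) + ((3z² − 4z + 1)/2)·h(z). -/

import Mathlib

/-- A function `ℂ → ℂ` is analytic on the closed disk `D(0,r)` if it is complex-analytic at
every point of the closed ball `{|z| ≤ r}` (equivalently, analytic on an open neighborhood). -/
def AnalyticOnDisk (g : ℂ → ℂ) (r : ℝ) : Prop :=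
  AnalyticOnNhd ℂ g (Metric.closedBall (0 : ℂ) r)

open Metric Set Filter Topology

lemma sq_mul_mem {R : ℝ} {z : ℂ} (hz : z ∈ ball (0 : ℂ) R) {s : ℝ} (hs : s ∈ Icc (0 : ℝ) 1) :
    ((s : ℂ) ^ 2 * z) ∈ ball (0 : ℂ) R := by
  rw [mem_ball_zero_iff] at hz ⊢
  have h1 : s ^ 2 ≤ 1 := by nlinarith [hs.1, hs.2]
  have : ‖(s : ℂ) ^ 2 * z‖ = s ^ 2 * ‖z‖ := by
    rw [norm_mul, norm_pow, Complex.norm_real, Real.norm_eq_abs, sq_abs]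
  rw [this]
  nlinarith [norm_nonneg z]

lemma ray_cont {R : ℝ} {G : ℂ → ℂ} (hG : ContinuousOn G (ball (0 : ℂ) R)) {z : ℂ}
    (hz : z ∈ ball (0 : ℂ) R) :
    ContinuousOn (fun s : ℝ => G ((s : ℂ) ^ 2 * z)) (Icc 0 1) := by
  refine hG.comp (by fun_prop) ?_
  intro s hs
  exact sq_mul_mem hz hs

lemma ray_ftc {R : ℝ} {G : ℂ → ℂ} (hG : DifferentiableOn ℂ G (ball (0 : ℂ) R)) {z : ℂ}
    (hz : z ∈ ball (0 : ℂ) R) :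
    ∫ s in (0 : ℝ)..1, (2 * ((s : ℂ) ^ 2 * z) * deriv G ((s : ℂ) ^ 2 * z)
      + G ((s : ℂ) ^ 2 * z)) = G z := by
  have hG' : DifferentiableOn ℂ (deriv G) (ball (0 : ℂ) R) := hG.deriv isOpen_ball
  have key := intervalIntegral.integral_eq_sub_of_hasDerivAt (a := 0) (b := 1)
    (f := fun s : ℝ => (s : ℂ) * G ((s : ℂ) ^ 2 * z))
    (f' := fun s : ℝ => 2 * ((s : ℂ) ^ 2 * z) * deriv G ((s : ℂ) ^ 2 * z)
      + G ((s : ℂ) ^ 2 * z)) ?_ ?_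
  · rw [key]; simp
  · intro s hs
    rw [uIcc_of_le zero_le_one] at hs
    have hd : HasDerivAt G (deriv G ((s : ℂ) ^ 2 * z)) ((s : ℂ) ^ 2 * z) :=
      (hG.differentiableAt (isOpen_ball.mem_nhds (sq_mul_mem hz hs))).hasDerivAt
    have h2 : HasDerivAt (fun w : ℂ => w ^ 2 * z) (2 * (s : ℂ) * z) (s : ℂ) := by
      simpa using (hasDerivAt_pow 2 (s : ℂ)).mul_const z
    have h3 : HasDerivAt (fun w : ℂ => w * G (w ^ 2 * z))
        (1 * G ((s : ℂ) ^ 2 * z) + (s : ℂ) * (deriv G ((s : ℂ) ^ 2 * z) * (2 * (s : ℂ) * z)))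
        (s : ℂ) :=
      (hasDerivAt_id (s : ℂ)).mul (HasDerivAt.comp (s : ℂ) hd h2)
    have e : 1 * G ((s : ℂ) ^ 2 * z) + (s : ℂ) * (deriv G ((s : ℂ) ^ 2 * z) * (2 * (s : ℂ) * z))
        = 2 * ((s : ℂ) ^ 2 * z) * deriv G ((s : ℂ) ^ 2 * z) + G ((s : ℂ) ^ 2 * z) := by ring
    rw [e] at h3
    exact h3.comp_ofReal
  · apply ContinuousOn.intervalIntegrable
    rw [uIcc_of_le zero_le_one]
    have h1 := ray_cont hG.continuousOn hz
    have h2 := ray_cont hG'.continuousOn hz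
    exact ((by fun_prop : ContinuousOn (fun s : ℝ => 2 * ((s : ℂ) ^ 2 * z)) (Icc 0 1)).mul h2).add h1

lemma exists_K {R : ℝ} {G : ℂ → ℂ} (hG : DifferentiableOn ℂ G (ball (0 : ℂ) R)) :
    ∃ K : ℂ → ℂ, DifferentiableOn ℂ K (ball (0 : ℂ) R) ∧
      ∀ z ∈ ball (0 : ℂ) R, z * deriv K z + K z / 2 = G z := by
  have hG' : DifferentiableOn ℂ (deriv G) (ball (0 : ℂ) R) := hG.deriv isOpen_ball
  have main : ∀ z ∈ ball (0 : ℂ) R,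
      HasDerivAt (fun w : ℂ => ∫ s in (0 : ℝ)..1, G ((s : ℂ) ^ 2 * w))
        (∫ s in (0 : ℝ)..1, (s : ℂ) ^ 2 * deriv G ((s : ℂ) ^ 2 * z)) z := by
    intro z hz
    have hz' : ‖z‖ < R := by simpa using hz
    obtain ⟨ρ, h1, h2⟩ := exists_between hz'
    obtain ⟨C, hC⟩ := (isCompact_closedBall (0 : ℂ) ρ).exists_bound_of_continuousOn
      (hG'.continuousOn.mono (closedBall_subset_ball h2))
    have hsub : ball (0 : ℂ) ρ ⊆ ball 0 R := ball_subset_ball h2.le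
    have hzρ : z ∈ ball (0 : ℂ) ρ := by simpa using h1
    have mm : ∀ {F : ℂ → ℂ}, ContinuousOn F (ball (0 : ℂ) R) → ∀ w ∈ ball (0 : ℂ) R,
        IntervalIntegrable (fun s : ℝ => F ((s : ℂ) ^ 2 * w)) MeasureTheory.volume 0 1 := by
      intro F hF w hw
      apply ContinuousOn.intervalIntegrable
      rw [uIcc_of_le zero_le_one]
      exact ray_cont hF hw
    refine (intervalIntegral.hasDerivAt_integral_of_dominated_loc_of_deriv_le
      (F := fun (w : ℂ) (s : ℝ) => G ((s : ℂ) ^ 2 * w))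
      (F' := fun (w : ℂ) (s : ℝ) => (s : ℂ) ^ 2 * deriv G ((s : ℂ) ^ 2 * w))
      (bound := fun _ => C) (isOpen_ball.mem_nhds hzρ) ?_ ?_ ?_ ?_ ?_ ?_).2
    · filter_upwards [isOpen_ball.mem_nhds hz] with w hw
      exact (mm hG.continuousOn w hw).aestronglyMeasurable_restrict_uIoc
    · exact mm hG.continuousOn z hz
    · refine IntervalIntegrable.aestronglyMeasurable_restrict_uIoc (μ := MeasureTheory.volume) ?_
      apply ContinuousOn.intervalIntegrable
      rw [uIcc_of_le zero_le_one]
      exact (by fun_prop : ContinuousOn (fun s : ℝ => (s : ℂ) ^ 2) (Icc 0 1)).mul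
        (ray_cont hG'.continuousOn hz)
    · refine Eventually.of_forall fun s hs w hw => ?_
      rw [uIoc_of_le zero_le_one] at hs
      have hs' : s ∈ Icc (0 : ℝ) 1 := Ioc_subset_Icc_self hs
      have hb := hC _ (ball_subset_closedBall (sq_mul_mem hw hs'))
      rw [norm_mul, norm_pow, Complex.norm_real, Real.norm_eq_abs, sq_abs]
      have h1 : s ^ 2 ≤ 1 := by nlinarith [hs'.1, hs'.2]
      nlinarith [norm_nonneg (deriv G ((s : ℂ) ^ 2 * w))]
    · exact intervalIntegrable_const
    · refine Eventually.of_forall fun s hs w hw => ?_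
      rw [uIoc_of_le zero_le_one] at hs
      have hs' : s ∈ Icc (0 : ℝ) 1 := Ioc_subset_Icc_self hs
      have hd : HasDerivAt G (deriv G ((s : ℂ) ^ 2 * w)) ((s : ℂ) ^ 2 * w) :=
        (hG.differentiableAt (isOpen_ball.mem_nhds (sq_mul_mem (hsub hw) hs'))).hasDerivAt
      have h2 : HasDerivAt (fun w : ℂ => (s : ℂ) ^ 2 * w) ((s : ℂ) ^ 2) w := by
        simpa using (hasDerivAt_id w).const_mul ((s : ℂ) ^ 2)
      have := HasDerivAt.comp w hd h2
      rw [mul_comm]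
      exact this
  refine ⟨fun w => 2 * ∫ s in (0 : ℝ)..1, G ((s : ℂ) ^ 2 * w), ?_, ?_⟩
  · intro z hz
    exact ((main z hz).const_mul 2).differentiableAt.differentiableWithinAt
  · intro z hz
    rw [((main z hz).const_mul 2).deriv, ← ray_ftc hG hz, intervalIntegral.integral_add]
    · rw [mul_div_cancel_left₀ _ (two_ne_zero), ← mul_assoc,
        ← intervalIntegral.integral_const_mul]
      congr 2
      ext s
      ring
    · apply ContinuousOn.intervalIntegrable
      rw [uIcc_of_le zero_le_one]
      exact (by fun_prop : ContinuousOn (fun s : ℝ => 2 * ((s : ℂ) ^ 2 * z)) (Icc 0 1)).mul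
        (ray_cont hG'.continuousOn hz)
    · apply ContinuousOn.intervalIntegrable
      rw [uIcc_of_le zero_le_one]
      exact ray_cont hG.continuousOn hz

lemma uniq_aux (r : ℝ) (hr : 1 ≤ r) (β γ : ℂ) (h : ℂ → ℂ) 
    (hh : AnalyticOnNhd ℂ h (closedBall (0 : ℂ) r))
    (he : ∀ z ∈ closedBall (0 : ℂ) r, 0 = β + γ * (z - 1) + z * (z - 1) ^ 2 * deriv h z
          + (3 * z ^ 2 - 4 * z + 1) / 2 * h z) :
    β = 0 ∧ γ = 0 ∧ ∀ z ∈ closedBall (0 : ℂ) r, h z = 0 := by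
  have h1mem : (1 : ℂ) ∈ closedBall (0 : ℂ) r := by simpa using hr
  have h0mem : (0 : ℂ) ∈ closedBall (0 : ℂ) r := by simp; linarith
  have hβ : β = 0 := by
    have := he 1 h1mem
    norm_num at this
    exact this.symm
  subst hβ
  have hpre : IsPreconnected (closedBall (0 : ℂ) r) := (convex_closedBall _ _).isPreconnected
  set m : ℂ → ℂ := fun z => (z - 1) * h z + 2 * γ with hm
  have hma : AnalyticOnNhd ℂ m (closedBall (0 : ℂ) r) := by
    intro z hz
    have := hh z hz
    fun_prop
  have hsub : ball (0 : ℂ) 1 ⊆ closedBall 0 r :=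
    (ball_subset_ball hr).trans ball_subset_closedBall
  have hode : ∀ z ∈ ball (0 : ℂ) 1, 2 * z * deriv m z + m z = 0 := by
    intro z hz
    have hd : HasDerivAt h (deriv h z) z := (hh z (hsub hz)).differentiableAt.hasDerivAt
    have hmd : HasDerivAt m (1 * h z + (z - 1) * deriv h z) z :=
      (((hasDerivAt_id z).sub_const 1).mul hd).add_const (2 * γ)
    have hz1 : z - 1 ≠ 0 := by
      intro h0
      rw [sub_eq_zero.mp h0] at hz
      simp at hz
    rw [hmd.deriv]
    apply mul_left_cancel₀ hz1
    have := he z (hsub hz)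
    simp only [hm]
    linear_combination -2 * this
  have hm0 : ∀ z ∈ ball (0 : ℂ) 1, m z = 0 := by
    intro z hz
    have hmd : DifferentiableOn ℂ m (ball (0 : ℂ) 1) := fun w hw =>
      (hma w (hsub hw)).differentiableAt.differentiableWithinAt
    rw [← ray_ftc hmd hz]
    rw [intervalIntegral.integral_congr (g := fun _ => (0 : ℂ))]
    · simp
    · intro s hs
      rw [uIcc_of_le zero_le_one] at hs
      exact hode _ (sq_mul_mem hz hs)
  have hb : ball (0 : ℂ) 1 ∈ 𝓝 (0 : ℂ) := ball_mem_nhds _ one_pos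
  have hmall := hma.eqOn_zero_of_preconnected_of_eventuallyEq_zero hpre h0mem
    (by filter_upwards [hb] with z hz using hm0 z hz)
  have hγ : γ = 0 := by
    have := hmall h1mem
    simpa [hm] using this
  subst hγ
  refine ⟨rfl, rfl, ?_⟩
  refine fun z hz => hh.eqOn_zero_of_preconnected_of_eventuallyEq_zero hpre h0mem ?_ hz
  filter_upwards [hb] with z hz
  have hz1 : z - 1 ≠ 0 := by
    intro h0
    rw [sub_eq_zero.mp h0] at hz
    simp at hz
  have := hm0 z hz
  simpa [hm, hz1] using this

lemma exist_aux (r : ℝ) (hr : 1 ≤ r) (g : ℂ → ℂ)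
    (hg : AnalyticOnNhd ℂ g (closedBall (0 : ℂ) r)) :
    ∃ (β γ : ℂ) (h : ℂ → ℂ), AnalyticOnNhd ℂ h (closedBall (0 : ℂ) r) ∧
      ∀ z ∈ closedBall (0 : ℂ) r,
        g z = β + γ * (z - 1) + z * (z - 1) ^ 2 * deriv h z
          + (3 * z ^ 2 - 4 * z + 1) / 2 * h z := by
  obtain ⟨δ, hδ, hsubset⟩ := (isCompact_closedBall (0 : ℂ) r).exists_thickening_subset_open
    (isOpen_analyticAt ℂ g) hg
  rw [thickening_closedBall hδ (by linarith)] at hsubset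
  set R := δ + r with hR
  have hsub : closedBall (0 : ℂ) r ⊆ ball 0 R := closedBall_subset_ball (by linarith)
  have hgd : DifferentiableOn ℂ g (ball (0 : ℂ) R) := fun w hw =>
    (hsubset hw).differentiableAt.differentiableWithinAt
  have h1 : ball (0 : ℂ) R ∈ 𝓝 (1 : ℂ) := isOpen_ball.mem_nhds (by simp; linarith)
  have hGd : DifferentiableOn ℂ (dslope g 1) (ball (0 : ℂ) R) :=
    (Complex.differentiableOn_dslope h1).2 hgd
  obtain ⟨K, hK, hKe⟩ := exists_K hGd
  have hhd : DifferentiableOn ℂ (dslope K 1) (ball (0 : ℂ) R) :=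
    (Complex.differentiableOn_dslope h1).2 hK
  refine ⟨g 1, K 1 / 2, dslope K 1, fun z hz => hhd.analyticAt (isOpen_ball.mem_nhds (hsub hz)), ?_⟩
  intro z hz
  have hz' := hsub hz
  have hKf : K = fun w => (w - 1) * dslope K 1 w + K 1 := by
    ext w
    have := sub_smul_dslope K 1 w
    rw [smul_eq_mul] at this
    rw [this]; ring
  have hd : HasDerivAt (dslope K 1) (deriv (dslope K 1) z) z :=
    (hhd.differentiableAt (isOpen_ball.mem_nhds hz')).hasDerivAt
  have hKd : HasDerivAt K (1 * dslope K 1 z + (z - 1) * deriv (dslope K 1) z) z := by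
    have := (((hasDerivAt_id z).sub_const 1).mul hd).add_const (K 1)
    exact this.congr_of_eventuallyEq (Eventually.of_forall fun w => congrFun hKf w)
  have e1 := hKe z hz'
  have e2 := sub_smul_dslope K 1 z
  have e3 := sub_smul_dslope g 1 z
  rw [smul_eq_mul] at e2 e3
  rw [hKd.deriv] at e1
  linear_combination -e3 - (z - 1) * e1 - (z - 1) / 2 * e2

theorem statement9 (r : ℝ) (hr : 1 ≤ r) (g : ℂ → ℂ) (hg : AnalyticOnDisk g r) :
    (∃ (β γ : ℂ) (h : ℂ → ℂ), AnalyticOnDisk h r ∧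
      ∀ z ∈ Metric.closedBall (0 : ℂ) r,
        g z = β + γ * (z - 1) + z * (z - 1) ^ 2 * deriv h z
          + (3 * z ^ 2 - 4 * z + 1) / 2 * h z) ∧
    (∀ (β₁ β₂ γ₁ γ₂ : ℂ) (h₁ h₂ : ℂ → ℂ), AnalyticOnDisk h₁ r → AnalyticOnDisk h₂ r →
      (∀ z ∈ Metric.closedBall (0 : ℂ) r,
        g z = β₁ + γ₁ * (z - 1) + z * (z - 1) ^ 2 * deriv h₁ z
          + (3 * z ^ 2 - 4 * z + 1) / 2 * h₁ z) →
      (∀ z ∈ Metric.closedBall (0 : ℂ) r,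
        g z = β₂ + γ₂ * (z - 1) + z * (z - 1) ^ 2 * deriv h₂ z
          + (3 * z ^ 2 - 4 * z + 1) / 2 * h₂ z) →
      β₁ = β₂ ∧ γ₁ = γ₂ ∧ ∀ z ∈ Metric.closedBall (0 : ℂ) r, h₁ z = h₂ z) := by
  refine ⟨exist_aux r hr g hg, ?_⟩
  intro β₁ β₂ γ₁ γ₂ h₁ h₂ a₁ a₂ e₁ e₂
  obtain ⟨p, q, s⟩ := uniq_aux r hr (β₁ - β₂) (γ₁ - γ₂) (fun z => h₁ z - h₂ z)
    (fun z hz => (a₁ z hz).sub (a₂ z hz)) (by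
      intro z hz
      rw [deriv_fun_sub (a₁ z hz).differentiableAt (a₂ z hz).differentiableAt]
      linear_combination e₁ z hz - e₂ z hz)
  exact ⟨sub_eq_zero.mp p, sub_eq_zero.mp q, fun z hz => sub_eq_zero.mp (s z hz)⟩
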